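/- (Proposition 0.3(ii)) Let I ⊆ ℝ be a nondegenerate interval such that either 0 ∈ I or 0 is the left endpoint of I (i.e., 0 = inf I), let φ be operator monotone on I, let J ⊆ ℝ be a nondegenerate interval, and let f be strongly operator convex on J with f(J) ⊆ I. Then the composite φ∘f is operator convex on J. -/

import Mathlib

open Matrix Set
open scoped ComplexOrder

/-- `f` is operator monotone on `I ⊆ ℝ`: for every `n ≥ 1` and all `n×n` Hermitian complex
matrices `A, B` with spectra (eigenvalues) contained in `I`, `A ≤ B` in the Loewner order
implies `f(A) ≤ f(B)`, where `f(A)` is given by the functional calculus. -/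
def OperatorMonotoneOn (f : ℝ → ℝ) (I : Set ℝ) : Prop :=
  ∀ (n : ℕ), 0 < n → ∀ (A B : Matrix (Fin n) (Fin n) ℂ)
    (hA : A.IsHermitian) (hB : B.IsHermitian),
    (∀ i, hA.eigenvalues i ∈ I) → (∀ i, hB.eigenvalues i ∈ I) →
    (B - A).PosSemidef → (hB.cfc f - hA.cfc f).PosSemidef

/-- `f` is operator convex on `I ⊆ ℝ`: for every `n ≥ 1`, every `t ∈ [0,1]` and all `n×n`
Hermitian complex matrices `A, B` with spectra contained in `I`,
`f(tA + (1−t)B) ≤ t·f(A) + (1−t)·f(B)` in the Loewner order. -/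
def OperatorConvexOn (f : ℝ → ℝ) (I : Set ℝ) : Prop :=
  ∀ (n : ℕ), 0 < n → ∀ t : ℝ, t ∈ Set.Icc (0 : ℝ) 1 →
  ∀ (A B : Matrix (Fin n) (Fin n) ℂ) (hA : A.IsHermitian) (hB : B.IsHermitian)
    (hAB : ((t : ℂ) • A + ((1 : ℂ) - (t : ℂ)) • B).IsHermitian),
    (∀ i, hA.eigenvalues i ∈ I) → (∀ i, hB.eigenvalues i ∈ I) →
    ((t : ℂ) • hA.cfc f + ((1 : ℂ) - (t : ℂ)) • hB.cfc f - hAB.cfc f).PosSemidef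

/-- `f` is strongly operator convex on `I ⊆ ℝ`: there is `x₀ ∈ I` such that for every `n ≥ 1`,
every `n×n` orthogonal projection `P` and every `n×n` Hermitian matrix `H` with spectrum
contained in `I`, `P·f(PHP + x₀(1−P))·P ≤ f(H)` in the Loewner order. -/
def StronglyOperatorConvexOn (f : ℝ → ℝ) (I : Set ℝ) : Prop :=
  ∃ x₀ ∈ I, ∀ (n : ℕ), 0 < n → ∀ (P H : Matrix (Fin n) (Fin n) ℂ),
    P.IsHermitian → P * P = P →
    ∀ (hH : H.IsHermitian)
      (hK : (P * H * P + (x₀ : ℂ) • ((1 : Matrix (Fin n) (Fin n) ℂ) - P)).IsHermitian),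
    (∀ i, hH.eigenvalues i ∈ I) →
    (hH.cfc f - P * hK.cfc f * P).PosSemidef

open scoped MatrixOrder

theorem Matrix.toBlocks₁₁_mono {ι : Type*} {A B : Matrix (ι ⊕ ι) (ι ⊕ ι) ℂ} (h : A ≤ B) :
    A.toBlocks₁₁ ≤ B.toBlocks₁₁ :=
  (le_iff.1 h).submatrix Sum.inl

theorem Matrix.toBlocks₂₂_mono {ι : Type*} {A B : Matrix (ι ⊕ ι) (ι ⊕ ι) ℂ} (h : A ≤ B) :
    A.toBlocks₂₂ ≤ B.toBlocks₂₂ :=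
  (le_iff.1 h).submatrix Sum.inr

section FunctionalCalculus

variable {ι κ : Type*} [Fintype ι] [DecidableEq ι] [Fintype κ] [DecidableEq κ]

theorem Matrix.continuousOn_spectrum (f : ℝ → ℝ) (A : Matrix ι ι ℂ) :
    ContinuousOn f (spectrum ℝ A) :=
  A.finite_real_spectrum.continuousOn f

theorem Matrix.IsHermitian.cfc_comp_eq {A : Matrix ι ι ℂ} (hA : A.IsHermitian) (g f : ℝ → ℝ) :
    cfc (g ∘ f) A = cfc g (cfc f A) :=
  _root_.cfc_comp g f A hA.isSelfAdjoint ((A.finite_real_spectrum.image f).continuousOn g)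
    (continuousOn_spectrum f A)

theorem Matrix.IsHermitian.spectrum_cfc {A : Matrix ι ι ℂ} (hA : A.IsHermitian) (f : ℝ → ℝ) :
    spectrum ℝ (cfc f A) = f '' spectrum ℝ A :=
  cfc_map_spectrum f A hA.isSelfAdjoint (continuousOn_spectrum f A)

theorem Matrix.isHermitian_cfc (f : ℝ → ℝ) (A : Matrix ι ι ℂ) : (cfc f A).IsHermitian :=
  cfc_predicate f A

theorem Matrix.IsHermitian.eigenvalues_mem_iff {A : Matrix ι ι ℂ} (hA : A.IsHermitian)
    {s : Set ℝ} : (∀ i, hA.eigenvalues i ∈ s) ↔ spectrum ℝ A ⊆ s := by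
  rw [hA.spectrum_real_eq_range_eigenvalues, Set.range_subset_iff]

theorem Set.Finite.exists_polynomial_eqOn {s : Set ℝ} (hs : s.Finite) (f : ℝ → ℝ) :
    ∃ p : Polynomial ℝ, s.EqOn f (fun x => p.eval x) := by
  refine ⟨Lagrange.interpolate hs.toFinset id f, fun x hx => ?_⟩
  have := Lagrange.eval_interpolate_at_node f (s := hs.toFinset) (v := id)
    Function.injective_id.injOn (i := x) (by simpa using hx)
  exact this.symm

theorem Matrix.IsHermitian.cfc_eq_aeval {A : Matrix ι ι ℂ} (hA : A.IsHermitian) {f : ℝ → ℝ}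
    {p : Polynomial ℝ} (h : (spectrum ℝ A).EqOn f (fun x => p.eval x)) :
    cfc f A = Polynomial.aeval A p := by
  rw [cfc_congr h]
  exact cfc_polynomial p A hA.isSelfAdjoint

theorem Matrix.IsHermitian.map_cfc {A : Matrix ι ι ℂ} (hA : A.IsHermitian)
    (Φ : Matrix ι ι ℂ →⋆ₐ[ℝ] Matrix κ κ ℂ) (f : ℝ → ℝ) :
    cfc f (Φ A) = Φ (cfc f A) := by
  obtain ⟨p, hp⟩ := A.finite_real_spectrum.exists_polynomial_eqOn f
  have hΦ : (Φ A).IsHermitian := hA.isSelfAdjoint.map Φ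
  rw [hA.cfc_eq_aeval hp, hΦ.cfc_eq_aeval (hp.mono (AlgHom.spectrum_apply_subset Φ A))]
  exact Polynomial.aeval_algHom_apply Φ A p

theorem Matrix.spectrum_map_prod_subset (A B : Matrix ι ι ℂ)
    (Φ : Matrix ι ι ℂ × Matrix ι ι ℂ →⋆ₐ[ℝ] Matrix κ κ ℂ) :
    spectrum ℝ (Φ (A, B)) ⊆ spectrum ℝ A ∪ spectrum ℝ B := by
  rw [← Prod.spectrum_eq]
  exact AlgHom.spectrum_apply_subset Φ (A, B)

theorem Matrix.IsHermitian.map_prod {A B : Matrix ι ι ℂ} (hA : A.IsHermitian)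
    (hB : B.IsHermitian) (Φ : Matrix ι ι ℂ × Matrix ι ι ℂ →⋆ₐ[ℝ] Matrix κ κ ℂ) :
    (Φ (A, B)).IsHermitian :=
  IsSelfAdjoint.map (x := (A, B)) (Prod.ext hA hB) Φ

theorem Matrix.IsHermitian.map_prod_cfc {A B : Matrix ι ι ℂ} (hA : A.IsHermitian)
    (hB : B.IsHermitian) (Φ : Matrix ι ι ℂ × Matrix ι ι ℂ →⋆ₐ[ℝ] Matrix κ κ ℂ) (f : ℝ → ℝ) :
    cfc f (Φ (A, B)) = Φ (cfc f A, cfc f B) := by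
  obtain ⟨p, hp⟩ :=
    (A.finite_real_spectrum.union B.finite_real_spectrum).exists_polynomial_eqOn f
  have hAB : Polynomial.aeval (A, B) p = (Polynomial.aeval A p, Polynomial.aeval B p) :=
    Prod.ext (Polynomial.aeval_algHom_apply (AlgHom.fst ℝ _ _) (A, B) p).symm
      (Polynomial.aeval_algHom_apply (AlgHom.snd ℝ _ _) (A, B) p).symm
  rw [hA.cfc_eq_aeval (hp.mono Set.subset_union_left),
    hB.cfc_eq_aeval (hp.mono Set.subset_union_right),
    (hA.map_prod hB Φ).cfc_eq_aeval (hp.mono (spectrum_map_prod_subset A B Φ)),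
    ← hAB]
  exact Polynomial.aeval_algHom_apply Φ (A, B) p

/-- Conjugation of the block diagonal matrix with blocks `A` and `B` by the rotation with
cosine `a` and sine `c`, as a homomorphism in `(A, B)`. -/
noncomputable def Matrix.rotateBlocks (a c : ℝ) (h : a ^ 2 + c ^ 2 = 1) :
    Matrix ι ι ℂ × Matrix ι ι ℂ →⋆ₐ[ℝ] Matrix (ι ⊕ ι) (ι ⊕ ι) ℂ where
  toFun M := fromBlocks (a ^ 2 • M.1 + c ^ 2 • M.2) ((a * c) • (M.2 - M.1))
    ((a * c) • (M.2 - M.1)) (c ^ 2 • M.1 + a ^ 2 • M.2)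
  map_one' := by
    rw [← fromBlocks_one]
    congr 1 <;> simp [← add_smul, h, add_comm (c ^ 2)]
  map_mul' M N := by
    rw [fromBlocks_multiply]
    have h' : a ^ 2 = 1 - c ^ 2 := by linarith
    congr 1 <;>
    · simp only [Prod.fst_mul, Prod.snd_mul, add_mul, mul_add, sub_mul, mul_sub, smul_sub,
        smul_mul_smul_comm]
      match_scalars <;> ring_nf <;> grind
  map_zero' := by simp
  map_add' M N := by
    rw [fromBlocks_add]
    congr 1 <;> simp only [Prod.fst_add, Prod.snd_add] <;> module
  commutes' r := by
    rw [Algebra.algebraMap_eq_smul_one, Algebra.algebraMap_eq_smul_one, ← fromBlocks_one,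
      fromBlocks_smul]
    congr 1 <;> simp [← add_smul, h, add_comm (c ^ 2)]
  map_star' M := by
    simp [star_eq_conjTranspose, fromBlocks_conjTranspose, conjTranspose_smul]

theorem Matrix.rotateBlocks_apply (a c : ℝ) (h : a ^ 2 + c ^ 2 = 1) (A B : Matrix ι ι ℂ) :
    rotateBlocks a c h (A, B) = fromBlocks (a ^ 2 • A + c ^ 2 • B) ((a * c) • (B - A))
      ((a * c) • (B - A)) (c ^ 2 • A + a ^ 2 • B) := rfl

theorem Matrix.rotateBlocks_one_zero (A B : Matrix ι ι ℂ) :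
    rotateBlocks 1 0 (by simp) (A, B) = fromBlocks A 0 0 B := by
  simp [rotateBlocks_apply]

theorem Matrix.IsHermitian.cfc_fromBlocks {A B : Matrix ι ι ℂ} (hA : A.IsHermitian)
    (hB : B.IsHermitian) (f : ℝ → ℝ) :
    cfc f (Matrix.fromBlocks A 0 0 B) = Matrix.fromBlocks (cfc f A) 0 0 (cfc f B) := by
  simp only [← rotateBlocks_one_zero, hA.map_prod_cfc hB]

theorem Matrix.spectrum_fromBlocks_subset (A B : Matrix ι ι ℂ) :
    spectrum ℝ (fromBlocks A 0 0 B) ⊆ spectrum ℝ A ∪ spectrum ℝ B := by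
  rw [← rotateBlocks_one_zero]
  exact spectrum_map_prod_subset A B _

/-- Reindexing of square matrices along an equivalence, as a star algebra homomorphism. -/
noncomputable def Matrix.reindexStarAlgHom (e : ι ≃ κ) : Matrix ι ι ℂ →⋆ₐ[ℝ] Matrix κ κ ℂ where
  __ := (reindexAlgEquiv ℝ ℂ e : Matrix ι ι ℂ →ₐ[ℝ] Matrix κ κ ℂ)
  map_star' M := by
    simp [star_eq_conjTranspose]

theorem Matrix.reindexStarAlgHom_apply (e : ι ≃ κ) (A : Matrix ι ι ℂ) :
    reindexStarAlgHom e A = A.submatrix e.symm e.symm := rfl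

theorem Matrix.reindexStarAlgHom_le_iff (e : ι ≃ κ) {A B : Matrix ι ι ℂ} :
    reindexStarAlgHom e A ≤ reindexStarAlgHom e B ↔ A ≤ B := by
  rw [le_iff, le_iff, ← map_sub, reindexStarAlgHom_apply, posSemidef_submatrix_equiv]

theorem OperatorMonotoneOn.cfc_le_cfc {φ : ℝ → ℝ} {I : Set ℝ} (hφ : OperatorMonotoneOn φ I)
    [Nonempty ι] {A B : Matrix ι ι ℂ} (hA : A.IsHermitian) (hB : B.IsHermitian)
    (hAI : spectrum ℝ A ⊆ I) (hBI : spectrum ℝ B ⊆ I) (h : A ≤ B) : cfc φ A ≤ cfc φ B := by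
  let Φ := reindexStarAlgHom (Fintype.equivFin ι)
  have hA' : (Φ A).IsHermitian := hA.isSelfAdjoint.map Φ
  have hB' : (Φ B).IsHermitian := hB.isSelfAdjoint.map Φ
  have key := hφ (Fintype.card ι) Fintype.card_pos (Φ A) (Φ B) hA' hB'
    (hA'.eigenvalues_mem_iff.2 ((AlgHom.spectrum_apply_subset Φ A).trans hAI))
    (hB'.eigenvalues_mem_iff.2 ((AlgHom.spectrum_apply_subset Φ B).trans hBI))
    ((reindexStarAlgHom_le_iff _).2 h)
  rw [← IsHermitian.cfc_eq, ← IsHermitian.cfc_eq, hA.map_cfc, hB.map_cfc] at key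
  exact (reindexStarAlgHom_le_iff _).1 key

theorem StronglyOperatorConvexOn.exists_compression_le {f : ℝ → ℝ} {J : Set ℝ}
    (hf : StronglyOperatorConvexOn f J) : ∃ x₀ ∈ J, ∀ {ι : Type} [Fintype ι] [DecidableEq ι]
    [Nonempty ι] {P H : Matrix ι ι ℂ}, P.IsHermitian → P * P = P → H.IsHermitian →
    spectrum ℝ H ⊆ J → P * cfc f (P * H * P + x₀ • (1 - P)) * P ≤ cfc f H := by
  obtain ⟨x₀, hx₀, hf⟩ := hf
  refine ⟨x₀, hx₀, fun {ι} _ _ _ P H hP hPP hH hHJ => ?_⟩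
  let Φ := reindexStarAlgHom (Fintype.equivFin ι)
  have hK : (P * H * P + x₀ • (1 - P)).IsHermitian := by
    refine .add ?_ ?_
    · simpa only [hP.eq] using isHermitian_mul_mul_conjTranspose P hH
    · exact (IsSelfAdjoint.all x₀).smul (isHermitian_one.sub hP).isSelfAdjoint
  have hP' : (Φ P).IsHermitian := hP.isSelfAdjoint.map Φ
  have hH' : (Φ H).IsHermitian := hH.isSelfAdjoint.map Φ
  have hK' : (Φ (P * H * P + x₀ • (1 - P))).IsHermitian := hK.isSelfAdjoint.map Φ
  have hΦK : Φ (P * H * P + x₀ • (1 - P)) =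
      Φ P * Φ H * Φ P + (x₀ : ℂ) • ((1 : Matrix _ _ ℂ) - Φ P) := by
    simp only [map_add, map_mul, map_smul, map_sub, map_one, Complex.coe_smul]
  have key := hf (Fintype.card ι) Fintype.card_pos (Φ P) (Φ H) hP'
    (by rw [← map_mul, hPP]) hH' (hΦK ▸ hK')
    (hH'.eigenvalues_mem_iff.2 ((AlgHom.spectrum_apply_subset Φ H).trans hHJ))
  rw [← IsHermitian.cfc_eq, ← IsHermitian.cfc_eq, ← hΦK, hH.map_cfc, hK.map_cfc, ← map_mul,
    ← map_mul] at key
  exact (reindexStarAlgHom_le_iff _).1 key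

end FunctionalCalculus

section BlockInequalities

variable {ι : Type*} [Fintype ι] [DecidableEq ι]

theorem Matrix.fromBlocks_algebraMap_nonneg {x y z : ℝ} (hx : 0 < x) (h : z ^ 2 ≤ x * y) :
    (0 : Matrix (ι ⊕ ι) (ι ⊕ ι) ℂ) ≤ fromBlocks (algebraMap ℝ _ x) (algebraMap ℝ _ z)
      (algebraMap ℝ _ z) (algebraMap ℝ _ y) := by
  let L : Matrix (ι ⊕ ι) (ι ⊕ ι) ℂ := fromBlocks (algebraMap ℝ _ √x) (algebraMap ℝ _ (z / √x))
    0 (algebraMap ℝ _ √(y - z ^ 2 / x))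
  have hstar (r : ℝ) : (algebraMap ℝ (Matrix ι ι ℂ) r)ᴴ = algebraMap ℝ _ r :=
    (IsSelfAdjoint.all r).algebraMap _
  have hy : 0 ≤ y - z ^ 2 / x := by
    rw [sub_nonneg, div_le_iff₀ hx]
    linarith
  have hx' : √x ≠ 0 := (Real.sqrt_pos.2 hx).ne'
  convert (posSemidef_conjTranspose_mul_self L).nonneg using 1
  simp only [L, fromBlocks_conjTranspose, fromBlocks_multiply, hstar, ← map_mul, ← map_add,
    conjTranspose_zero, zero_mul, mul_zero, add_zero]
  congr 2
  · rw [Real.mul_self_sqrt hx.le]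
  · field_simp
  · field_simp
  · rw [Real.mul_self_sqrt hy, div_mul_div_comm, Real.mul_self_sqrt hx.le]
    ring

theorem Matrix.PosSemidef.mul_eq_zero_of_conjTranspose_mul_mul {Y B : Matrix ι ι ℂ}
    (hY : Y.PosSemidef) (h : Bᴴ * Y * B = 0) : Y * B = 0 := by
  obtain ⟨Z, rfl⟩ := CStarAlgebra.nonneg_iff_eq_star_mul_self.1 hY.nonneg
  have hZ : Z * B = 0 := by
    rw [← conjTranspose_mul_self_eq_zero, ← h, conjTranspose_mul, star_eq_conjTranspose]
    noncomm_ring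
  rw [mul_assoc, hZ, mul_zero]

/-- On the eigenspace of `X` for an upper bound `b` of `F ≥ X`, the matrix `F` also acts as `b`. -/
theorem Matrix.mul_eq_smul_of_le {X F E : Matrix ι ι ℂ} {b : ℝ} (hXF : X ≤ F)
    (hFb : F ≤ algebraMap ℝ _ b) (hXE : X * E = b • E) : F * E = b • E := by
  have hY : (algebraMap ℝ _ b - F).PosSemidef := hFb
  have hsub : (algebraMap ℝ _ b - X) * E = 0 := by
    rw [sub_mul, hXE, Algebra.algebraMap_eq_smul_one, smul_one_mul, sub_self]
  have h0 : Eᴴ * (algebraMap ℝ _ b - F) * E = 0 := by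
    refine le_antisymm ?_ (hY.conjTranspose_mul_mul_same E).nonneg
    have := ((le_iff.1 hXF).conjTranspose_mul_mul_same E)
    rw [← nonneg_iff_posSemidef] at this
    have h2 : Eᴴ * (F - X) * E = -(Eᴴ * (algebraMap ℝ _ b - F) * E) := by
      have : F - X = (algebraMap ℝ _ b - X) - (algebraMap ℝ _ b - F) := by abel
      rw [this, mul_sub, sub_mul, mul_assoc, hsub, mul_zero, zero_sub]
    rw [h2] at this
    exact neg_nonneg.1 this
  have := hY.mul_eq_zero_of_conjTranspose_mul_mul h0
  rw [sub_mul, Algebra.algebraMap_eq_smul_one, smul_one_mul, sub_eq_zero] at this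
  exact this.symm

theorem Matrix.add_smul_projection_le {F E : Matrix ι ι ℂ} {m b : ℝ} (hE : E.IsHermitian)
    (hEE : E * E = E) (hmF : algebraMap ℝ _ m ≤ F) (hF : F.IsHermitian) (hFE : F * E = b • E) :
    algebraMap ℝ _ m + (b - m) • E ≤ F := by
  have hEF : E * F = b • E := by
    simpa [conjTranspose_mul, hE.eq, hF.eq, conjTranspose_smul] using congr(($hFE)ᴴ)
  have h := (le_iff.1 hmF).conjTranspose_mul_mul_same (1 - E)
  rw [le_iff]
  convert h using 1
  rw [(isHermitian_one.sub hE).eq, Algebra.algebraMap_eq_smul_one]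
  simp only [sub_mul, mul_sub, one_mul, mul_one, hEF, hFE, hEE, smul_mul_assoc, mul_smul_comm]
  module

/-- Moves every point other than `b` towards `m`. -/
noncomputable def moveTowards (m b δ x : ℝ) : ℝ :=
  if x = b then b else (1 - δ) * x + δ * m

theorem Matrix.fromBlocks_moveTowards_le {D : Matrix ι ι ℂ} {F : Matrix (ι ⊕ ι) (ι ⊕ ι) ℂ}
    (hD : D.IsHermitian) (hF : F.IsHermitian) {m b δ : ℝ} (hδ : δ ∈ Set.Icc (0 : ℝ) 1)
    (hDF : fromBlocks D 0 0 0 ≤ F) (hmF : algebraMap ℝ _ m ≤ F) (hFb : F ≤ algebraMap ℝ _ b) :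
    fromBlocks (cfc (moveTowards m b δ) D) 0 0 (algebraMap ℝ _ (δ * m)) ≤ F := by
  set χ : ℝ → ℝ := fun x => if x = b then 1 else 0 with hχ
  set E := cfc χ D with hE
  have hcont (f : ℝ → ℝ) := continuousOn_spectrum f D
  have hE' : E.IsHermitian := isHermitian_cfc χ D
  have hEE : E * E = E := by
    rw [hE, ← cfc_mul χ χ D (hcont _) (hcont _)]
    congr 1
    ext x
    simp [hχ]
  have hDE : D * E = b • E := by
    have hsa := hD.isSelfAdjoint
    rw [hE]
    nth_rw 1 [← cfc_id' ℝ D]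
    rw [← cfc_mul _ χ D (hcont _) (hcont _), ← cfc_const_mul b χ D (hcont _)]
    congr 1
    ext x
    by_cases h : x = b <;> simp [hχ, h]
  have hg : cfc (moveTowards m b δ) D =
      (1 - δ) • D + δ • (algebraMap ℝ _ m + (b - m) • E) := by
    have hsa := hD.isSelfAdjoint
    rw [hE, ← cfc_const_mul _ χ D (hcont _), ← cfc_const_add _ _ D (hcont _),
      ← cfc_const_mul _ _ D (hcont _), ← cfc_const_mul_id (1 - δ) D,
      ← cfc_add _ _ _ (hcont _) (hcont _)]
    congr 1
    ext x
    by_cases h : x = b <;> simp [moveTowards, hχ, h]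
    ring
  set E₀ : Matrix (ι ⊕ ι) (ι ⊕ ι) ℂ := fromBlocks E 0 0 0 with hE₀
  have hE₀' : E₀.IsHermitian := by
    rw [IsHermitian, hE₀, fromBlocks_conjTranspose, hE'.eq]
    simp
  have hE₀E₀ : E₀ * E₀ = E₀ := by simp [hE₀, fromBlocks_multiply, hEE]
  have hFE : F * E₀ = b • E₀ := by
    refine mul_eq_smul_of_le hDF hFb ?_
    simp [hE₀, fromBlocks_multiply, hDE, fromBlocks_smul]
  have hle := add_smul_projection_le hE₀' hE₀E₀ hmF hF hFE
  calc fromBlocks (cfc (moveTowards m b δ) D) 0 0 (algebraMap ℝ _ (δ * m))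
      = (1 - δ) • fromBlocks D 0 0 0 + δ • (algebraMap ℝ _ m + (b - m) • E₀) := by
        rw [hg, hE₀]
        simp only [Algebra.algebraMap_eq_smul_one, ← fromBlocks_one, fromBlocks_smul,
          fromBlocks_add, smul_zero, add_zero, zero_add, mul_smul]
    _ ≤ (1 - δ) • F + δ • F := by
        rw [le_iff]
        convert ((le_iff.1 hDF).smul (sub_nonneg.2 hδ.2)).add ((le_iff.1 hle).smul hδ.1) using 1
        module
    _ = F := by module

theorem Matrix.le_of_forall_pos_sub_le {A B : Matrix ι ι ℂ} (hA : A.IsHermitian)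
    (hB : B.IsHermitian) (h : ∀ η > 0, A - algebraMap ℝ _ η ≤ B) : A ≤ B := by
  have hBA : IsSelfAdjoint (B - A) := (hB.sub hA).isSelfAdjoint
  rw [← sub_nonneg, ← map_zero (algebraMap ℝ (Matrix ι ι ℂ)),
    algebraMap_le_iff_le_spectrum hBA]
  refine fun x hx => le_of_forall_pos_le_add fun η hη => ?_
  have : algebraMap ℝ _ (-η) ≤ B - A := by
    rw [map_neg, le_sub_iff_add_le, neg_add_eq_sub]
    exact h η hη
  linarith [(algebraMap_le_iff_le_spectrum hBA).1 this x hx]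

end BlockInequalities

theorem Matrix.spectrum_algebraMap_subset {ι : Type*} [Fintype ι] [DecidableEq ι] (r : ℝ) :
    spectrum ℝ (algebraMap ℝ (Matrix ι ι ℂ) r) ⊆ {r} := by
  cases isEmpty_or_nonempty ι
  · simp
  · rw [spectrum.scalar_eq]

theorem Matrix.isHermitian_algebraMap {ι : Type*} [Fintype ι] [DecidableEq ι] (r : ℝ) :
    (algebraMap ℝ (Matrix ι ι ℂ) r).IsHermitian :=
  (IsSelfAdjoint.all r).algebraMap _

/-- A one-sided Lipschitz estimate for operator monotone functions. -/
theorem OperatorMonotoneOn.sub_le {φ : ℝ → ℝ} {I : Set ℝ} (hφ : OperatorMonotoneOn φ I)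
    (hI : Convex ℝ I) {m x b δ : ℝ} (hm : m ∈ I) (hb : b ∈ I) (hmx : m < x) (hxb : x < b)
    (hδ : 0 ≤ δ) (hδ' : δ * (b - m) ≤ b - x) :
    φ x - δ * ((b - m) / (b - x) * (φ x - φ m)) ≤ φ ((1 - δ) * x + δ * m) := by
  set p := (1 - δ) * x + δ * m with hp
  set u := δ * (b - m) / (b - x) with hu
  have hbx : 0 < b - x := sub_pos.2 hxb
  have hux : u * (b - x) = δ * (b - m) := div_mul_cancel₀ _ hbx.ne'
  have hu0 : 0 ≤ u := div_nonneg (mul_nonneg hδ (by linarith)) hbx.le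
  have hu1 : u ≤ 1 := (div_le_one hbx).2 hδ'
  have hδ1 : δ ≤ 1 := by nlinarith
  have hord := hI.ordConnected
  have hx : x ∈ I := hord.out hm hb ⟨hmx.le, hxb.le⟩
  have hpI : p ∈ I := hord.out hm hx ⟨by nlinarith, by nlinarith⟩
  have hac : √u ^ 2 + √(1 - u) ^ 2 = 1 := by
    rw [Real.sq_sqrt hu0, Real.sq_sqrt (sub_nonneg.2 hu1)]
    ring
  let s : ℝ → Matrix Unit Unit ℂ := algebraMap ℝ _
  have hs (r : ℝ) : (s r).IsHermitian := isHermitian_algebraMap r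
  have hspec {r : ℝ} (hr : r ∈ I) : spectrum ℝ (s r) ⊆ I :=
    (spectrum_algebraMap_subset r).trans (Set.singleton_subset_iff.2 hr)
  have hcfc (r : ℝ) : cfc φ (s r) = s (φ r) := cfc_algebraMap r φ
  have hle : rotateBlocks √u √(1 - u) hac (s x, s m) ≤
      rotateBlocks 1 0 (by simp) (s b, s p) := by
    have hpos : 0 < b - (u * x + (1 - u) * m) := by nlinarith
    have hdet : (-(√u * √(1 - u) * (m - x))) ^ 2 ≤
        (b - (u * x + (1 - u) * m)) * (p - ((1 - u) * x + u * m)) := by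
      have h1 : (-(√u * √(1 - u) * (m - x))) ^ 2 = u * (1 - u) * (m - x) ^ 2 := by
        rw [neg_sq, mul_pow, mul_pow, Real.sq_sqrt hu0, Real.sq_sqrt (sub_nonneg.2 hu1)]
      have h2 : p - ((1 - u) * x + u * m) = (u - δ) * (x - m) := by rw [hp]; ring
      rw [h1, h2]
      have h3 : 0 ≤ δ * u * (x - m) * (x - m) := by
        have := sub_pos.2 hmx
        positivity
      have h4 : (b - (u * x + (1 - u) * m)) * ((u - δ) * (x - m)) - u * (1 - u) * (m - x) ^ 2
          = (x - m) * (u * (b - x) - δ * (b - m)) + δ * u * (x - m) * (x - m) := by ring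
      rw [hux, sub_self, mul_zero, zero_add] at h4
      linarith
    have key := fromBlocks_algebraMap_nonneg (ι := Unit) hpos hdet
    rw [rotateBlocks_one_zero, ← sub_nonneg]
    convert key using 1
    rw [rotateBlocks_apply, Real.sq_sqrt hu0, Real.sq_sqrt (sub_nonneg.2 hu1), sub_eq_add_neg,
      fromBlocks_neg, fromBlocks_add]
    simp only [s, Algebra.algebraMap_eq_smul_one]
    congr 1 <;> module
  have hsub {v w : ℝ} (hv : v ∈ I) (hw : w ∈ I)
      (Φ : Matrix Unit Unit ℂ × Matrix Unit Unit ℂ →⋆ₐ[ℝ] Matrix (Unit ⊕ Unit) (Unit ⊕ Unit) ℂ) :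
      spectrum ℝ (Φ (s v, s w)) ⊆ I :=
    (spectrum_map_prod_subset _ _ Φ).trans (Set.union_subset (hspec hv) (hspec hw))
  have hfin := hφ.cfc_le_cfc ((hs x).map_prod (hs m) _) ((hs b).map_prod (hs p) _)
    (hsub hx hm _) (hsub hb hpI _) hle
  rw [(hs x).map_prod_cfc (hs m), (hs b).map_prod_cfc (hs p), hcfc, hcfc, hcfc, hcfc,
    rotateBlocks_one_zero, rotateBlocks_apply] at hfin
  have hentry := (le_iff.1 (toBlocks₂₂_mono hfin)).diag_nonneg (i := ())
  rw [toBlocks_fromBlocks₂₂, toBlocks_fromBlocks₂₂, Real.sq_sqrt hu0,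
    Real.sq_sqrt (sub_nonneg.2 hu1)] at hentry
  have hre := (Complex.le_def.1 hentry).1
  simp [s, algebraMap_matrix_apply] at hre
  have : δ * ((b - m) / (b - x) * (φ x - φ m)) = u * (φ x - φ m) := by rw [hu]; ring
  linarith

open Filter Topology in
theorem OperatorMonotoneOn.eventually_sub_le_moveTowards {φ : ℝ → ℝ} {I : Set ℝ}
    (hφ : OperatorMonotoneOn φ I) (hI : Convex ℝ I) {m x b η : ℝ} (hm : m ∈ I) (hb : b ∈ I)
    (hmx : m ≤ x) (hxb : x ≤ b) (hη : 0 < η) :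
    ∀ᶠ δ in 𝓝[>] (0 : ℝ), φ x - η ≤ φ (moveTowards m b δ x) := by
  rcases hxb.eq_or_lt with rfl | hxb
  · simp [moveTowards, hη.le]
  rcases hmx.eq_or_lt with rfl | hmx
  · have (δ : ℝ) : (1 - δ) * m + δ * m = m := by ring
    simp [moveTowards, hxb.ne, this, hη.le]
  have hlim (k : ℝ) : Tendsto (fun δ : ℝ => δ * k) (𝓝[>] 0) (𝓝 0) := by
    have : Tendsto (fun δ : ℝ => δ * k) (𝓝 0) (𝓝 (0 * k)) :=
      (continuous_mul_const k).tendsto 0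
    rw [zero_mul] at this
    exact this.mono_left nhdsWithin_le_nhds
  filter_upwards [self_mem_nhdsWithin,
    (hlim (b - m)).eventually_le_const (sub_pos.2 hxb),
    (hlim ((b - m) / (b - x) * (φ x - φ m))).eventually_le_const hη] with δ hδ h1 h2
  rw [moveTowards, if_neg hxb.ne]
  linarith [hφ.sub_le hI hm hb hmx hxb (le_of_lt hδ) h1]

section Convexity

variable {ι : Type*} [Fintype ι] [DecidableEq ι]

theorem Matrix.spectrum_convexCombination_subset {J : Set ℝ} (hJ : Convex ℝ J) [Nonempty ι]
    {A B : Matrix ι ι ℂ} (hA : A.IsHermitian) (hB : B.IsHermitian) (hAJ : spectrum ℝ A ⊆ J)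
    (hBJ : spectrum ℝ B ⊆ J) {a b : ℝ} (ha : 0 ≤ a) (hb : 0 ≤ b) (hab : a + b = 1) :
    spectrum ℝ (a • A + b • B) ⊆ J := by
  have hfin := A.finite_real_spectrum.union B.finite_real_spectrum
  have hne : (spectrum ℝ A ∪ spectrum ℝ B).Nonempty :=
    (ContinuousFunctionalCalculus.spectrum_nonempty A hA.isSelfAdjoint).inl
  obtain ⟨l, hl, hl'⟩ := Set.exists_min_image _ id hfin hne
  obtain ⟨u, hu, hu'⟩ := Set.exists_max_image _ id hfin hne
  have hsub := Set.union_subset hAJ hBJ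
  have hC : IsSelfAdjoint (a • A + b • B) :=
    ((IsSelfAdjoint.all a).smul hA.isSelfAdjoint).add
      ((IsSelfAdjoint.all b).smul hB.isSelfAdjoint)
  have hcomb (r : ℝ) :
      algebraMap ℝ (Matrix ι ι ℂ) r = a • algebraMap ℝ _ r + b • algebraMap ℝ _ r := by
    rw [← add_smul, hab, one_smul]
  have hsmul {r : ℝ} (hr : 0 ≤ r) {X Y : Matrix ι ι ℂ} (h : X ≤ Y) : r • X ≤ r • Y := by
    rw [le_iff] at h ⊢
    rw [← smul_sub]
    exact h.smul hr
  have hlC : algebraMap ℝ _ l ≤ a • A + b • B := by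
    rw [hcomb l]
    exact add_le_add
      (hsmul ha ((algebraMap_le_iff_le_spectrum hA.isSelfAdjoint).2 fun x hx => hl' x (.inl hx)))
      (hsmul hb ((algebraMap_le_iff_le_spectrum hB.isSelfAdjoint).2 fun x hx => hl' x (.inr hx)))
  have huC : a • A + b • B ≤ algebraMap ℝ _ u := by
    rw [hcomb u]
    exact add_le_add
      (hsmul ha ((le_algebraMap_iff_spectrum_le hA.isSelfAdjoint).2 fun x hx => hu' x (.inl hx)))
      (hsmul hb ((le_algebraMap_iff_spectrum_le hB.isSelfAdjoint).2 fun x hx => hu' x (.inr hx)))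
  exact fun x hx => hJ.ordConnected.out (hsub hl) (hsub hu)
    ⟨(algebraMap_le_iff_le_spectrum hC).1 hlC x hx, (le_algebraMap_iff_spectrum_le hC).1 huC x hx⟩

theorem OperatorMonotoneOn.cfc_le_toBlocks₁₁_of_zero_mem {φ : ℝ → ℝ} {I : Set ℝ}
    (hφ : OperatorMonotoneOn φ I) (h0 : 0 ∈ I) [Nonempty ι] {D : Matrix ι ι ℂ}
    {F : Matrix (ι ⊕ ι) (ι ⊕ ι) ℂ} (hD : D.IsHermitian) (hF : F.IsHermitian)
    (hDI : spectrum ℝ D ⊆ I) (hFI : spectrum ℝ F ⊆ I) (hDF : fromBlocks D 0 0 0 ≤ F) :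
    cfc φ D ≤ (cfc φ F).toBlocks₁₁ := by
  have hspec : spectrum ℝ (fromBlocks D 0 0 (0 : Matrix ι ι ℂ)) ⊆ I := by
    refine (spectrum_fromBlocks_subset D 0).trans (Set.union_subset hDI ?_)
    rw [← map_zero (algebraMap ℝ (Matrix ι ι ℂ))]
    exact (spectrum_algebraMap_subset 0).trans (Set.singleton_subset_iff.2 h0)
  have hherm : (fromBlocks D 0 0 (0 : Matrix ι ι ℂ)).IsHermitian :=
    hD.fromBlocks (by simp) isHermitian_zero
  simpa [hD.cfc_fromBlocks isHermitian_zero] using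
    toBlocks₁₁_mono (hφ.cfc_le_cfc hherm hF hspec hFI hDF)

open Filter Topology in
theorem OperatorMonotoneOn.cfc_le_toBlocks₁₁_of_isGLB {φ : ℝ → ℝ} {I : Set ℝ}
    (hφ : OperatorMonotoneOn φ I) (hI : Convex ℝ I) (h0 : 0 ∉ I) (hglb : IsGLB I 0) [Nonempty ι]
    {D : Matrix ι ι ℂ} {F : Matrix (ι ⊕ ι) (ι ⊕ ι) ℂ} (hD : D.IsHermitian) (hF : F.IsHermitian)
    (hDI : spectrum ℝ D ⊆ I) (hFI : spectrum ℝ F ⊆ I) (hDF : fromBlocks D 0 0 0 ≤ F) :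
    cfc φ D ≤ (cfc φ F).toBlocks₁₁ := by
  have hpos {x : ℝ} (hx : x ∈ I) : 0 < x :=
    lt_of_le_of_ne (hglb.1 hx) fun h => h0 (h ▸ hx)
  have hfin := D.finite_real_spectrum.union F.finite_real_spectrum
  have hne : (spectrum ℝ D ∪ spectrum ℝ F).Nonempty :=
    (ContinuousFunctionalCalculus.spectrum_nonempty D hD.isSelfAdjoint).inl
  obtain ⟨m, hm, hm'⟩ := Set.exists_min_image _ id hfin hne
  obtain ⟨b, hb, hb'⟩ := Set.exists_max_image _ id hfin hne
  replace hm := Set.union_subset hDI hFI hm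
  replace hb := Set.union_subset hDI hFI hb
  have hord := hI.ordConnected
  have hmF : algebraMap ℝ _ m ≤ F :=
    (algebraMap_le_iff_le_spectrum hF.isSelfAdjoint).2 fun x hx => hm' x (.inr hx)
  have hFb : F ≤ algebraMap ℝ _ b :=
    (le_algebraMap_iff_spectrum_le hF.isSelfAdjoint).2 fun x hx => hb' x (.inr hx)
  refine le_of_forall_pos_sub_le (isHermitian_cfc φ D)
    ((isHermitian_cfc φ F).submatrix Sum.inl) fun η hη => ?_
  have hev : ∀ᶠ δ in 𝓝[>] (0 : ℝ), ∀ x ∈ spectrum ℝ D, φ x - η ≤ φ (moveTowards m b δ x) :=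
    (eventually_all_finite D.finite_real_spectrum).2 fun x hx =>
      hφ.eventually_sub_le_moveTowards hI hm hb (hm' x (.inl hx)) (hb' x (.inl hx)) hη
  obtain ⟨δ, hδ, hδ0, hδ1⟩ :=
    (hev.and (Ioo_mem_nhdsGT (show (0 : ℝ) < 1 from one_pos))).exists
  set G := cfc (moveTowards m b δ) D with hG
  have hGh : G.IsHermitian := isHermitian_cfc _ D
  have hGI : spectrum ℝ G ⊆ I := by
    rw [hG, hD.spectrum_cfc]
    rintro _ ⟨x, hx, rfl⟩
    unfold moveTowards
    split_ifs
    · exact hb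
    · exact hI (hDI hx) hm (by linarith) hδ0.le (by ring)
  have hδm : δ * m ∈ I := by
    obtain ⟨c, hc, -, hc'⟩ := hglb.exists_between (mul_pos hδ0 (hpos hm))
    exact hord.out hc hm ⟨hc'.le, by nlinarith [hpos hm]⟩
  have hspec : spectrum ℝ (fromBlocks G 0 0 (algebraMap ℝ _ (δ * m))) ⊆ I :=
    (spectrum_fromBlocks_subset _ _).trans (Set.union_subset hGI
      ((spectrum_algebraMap_subset _).trans (Set.singleton_subset_iff.2 hδm)))
  have hle := hφ.cfc_le_cfc (hGh.fromBlocks (by simp) (isHermitian_algebraMap _)) hF hspec hFI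
    (fromBlocks_moveTowards_le hD hF ⟨hδ0.le, hδ1.le⟩ hDF hmF hFb)
  rw [hGh.cfc_fromBlocks (isHermitian_algebraMap _)] at hle
  have hle' := toBlocks₁₁_mono hle
  rw [toBlocks_fromBlocks₁₁, hG, ← hD.cfc_comp_eq] at hle'
  refine le_trans ?_ hle'
  have hcont (f : ℝ → ℝ) := continuousOn_spectrum f D
  rw [← cfc_const η D hD.isSelfAdjoint, ← cfc_sub _ _ D (hcont _) (hcont _)]
  exact cfc_mono hδ (hcont _) (hcont _)

theorem StronglyOperatorConvexOn.fromBlocks_cfc_le {f : ℝ → ℝ} {J : Set ℝ}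
    (hf : StronglyOperatorConvexOn f J) {ι : Type} [Fintype ι] [DecidableEq ι] [Nonempty ι]
    {A B : Matrix ι ι ℂ} (hA : A.IsHermitian) (hB : B.IsHermitian) (hAJ : spectrum ℝ A ⊆ J)
    (hBJ : spectrum ℝ B ⊆ J) {a c : ℝ} (h : a ^ 2 + c ^ 2 = 1) :
    fromBlocks (cfc f (a ^ 2 • A + c ^ 2 • B)) 0 0 0 ≤ rotateBlocks a c h (cfc f A, cfc f B) := by
  obtain ⟨x₀, -, hf⟩ := hf.exists_compression_le
  let P : Matrix (ι ⊕ ι) (ι ⊕ ι) ℂ := fromBlocks 1 0 0 0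
  have hP : P.IsHermitian := isHermitian_one.fromBlocks (by simp) isHermitian_zero
  have hPP : P * P = P := by simp [P, fromBlocks_multiply]
  have key := hf hP hPP (hA.map_prod hB (rotateBlocks a c h))
    ((spectrum_map_prod_subset A B _).trans (Set.union_subset hAJ hBJ))
  have hC : (a ^ 2 • A + c ^ 2 • B).IsHermitian :=
    ((IsSelfAdjoint.all (a ^ 2)).smul hA.isSelfAdjoint).add
      ((IsSelfAdjoint.all (c ^ 2)).smul hB.isSelfAdjoint)
  have h1P : 1 - P = fromBlocks 0 0 0 1 := by
    rw [← fromBlocks_one, sub_eq_add_neg, fromBlocks_neg, fromBlocks_add]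
    simp
  have hblock : P * rotateBlocks a c h (A, B) * P + x₀ • (1 - P) =
      fromBlocks (a ^ 2 • A + c ^ 2 • B) 0 0 (algebraMap ℝ _ x₀) := by
    rw [rotateBlocks_apply, h1P, Algebra.algebraMap_eq_smul_one]
    simp [P, fromBlocks_multiply, fromBlocks_add, fromBlocks_smul]
  rw [hblock, hC.cfc_fromBlocks (isHermitian_algebraMap _), hA.map_prod_cfc hB] at key
  simpa [P, fromBlocks_multiply] using key

end Convexity

/-- Proposition 0.3(ii): if `φ` is operator monotone on `I` where `0 ∈ I` or `0`
is the left endpoint of `I`, and `f` is strongly operator convex on `J` with `f(J) ⊆ I`, then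
`φ∘f` is operator convex on `J`. -/
theorem stmt6 (I : Set ℝ) (hI : Convex ℝ I) (hnt : I.Nontrivial)
    (h0 : (0 : ℝ) ∈ I ∨ IsGLB I 0)
    (φ : ℝ → ℝ) (hφ : OperatorMonotoneOn φ I)
    (J : Set ℝ) (hJ : Convex ℝ J) (hJnt : J.Nontrivial)
    (f : ℝ → ℝ) (hf : StronglyOperatorConvexOn f J) (hfJ : f '' J ⊆ I) :
    OperatorConvexOn (φ ∘ f) J := by
  intro n hn t ht A B hA hB hAB hAJ hBJ
  have : Nonempty (Fin n) := ⟨⟨0, hn⟩⟩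
  rw [hA.eigenvalues_mem_iff] at hAJ
  rw [hB.eigenvalues_mem_iff] at hBJ
  have h1t : (1 : ℂ) - (t : ℂ) = ((1 - t : ℝ) : ℂ) := by push_cast; rfl
  simp only [h1t, Complex.coe_smul, ← IsHermitian.cfc_eq] at hAB ⊢
  have ha : √t ^ 2 = t := Real.sq_sqrt ht.1
  have hc : √(1 - t) ^ 2 = 1 - t := Real.sq_sqrt (sub_nonneg.2 ht.2)
  have hac : √t ^ 2 + √(1 - t) ^ 2 = 1 := by rw [ha, hc]; ring
  have hCJ := spectrum_convexCombination_subset hJ hA hB hAJ hBJ ht.1 (sub_nonneg.2 ht.2)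
    (by ring)
  have himage {X : Matrix (Fin n) (Fin n) ℂ} (hX : X.IsHermitian) (hXJ : spectrum ℝ X ⊆ J) :
      spectrum ℝ (cfc f X) ⊆ I := by
    rw [hX.spectrum_cfc]
    exact (Set.image_mono hXJ).trans hfJ
  have hle := hf.fromBlocks_cfc_le hA hB hAJ hBJ hac
  rw [ha, hc] at hle
  have hF := (isHermitian_cfc f A).map_prod (isHermitian_cfc f B) (rotateBlocks _ _ hac)
  have hFI := (spectrum_map_prod_subset (cfc f A) (cfc f B) (rotateBlocks _ _ hac)).trans
    (Set.union_subset (himage hA hAJ) (himage hB hBJ))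
  have key : cfc φ (cfc f (t • A + (1 - t) • B)) ≤
      (cfc φ (rotateBlocks _ _ hac (cfc f A, cfc f B))).toBlocks₁₁ := by
    by_cases h : (0 : ℝ) ∈ I
    · exact hφ.cfc_le_toBlocks₁₁_of_zero_mem h (isHermitian_cfc f _) hF (himage hAB hCJ) hFI hle
    · exact hφ.cfc_le_toBlocks₁₁_of_isGLB hI h (h0.resolve_left h) (isHermitian_cfc f _) hF
        (himage hAB hCJ) hFI hle
  rw [(isHermitian_cfc f A).map_prod_cfc (isHermitian_cfc f B), rotateBlocks_apply,
    toBlocks_fromBlocks₁₁, ha, hc, ← hA.cfc_comp_eq, ← hB.cfc_comp_eq, ← hAB.cfc_comp_eq] at key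
  exact le_iff.1 key
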